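/- arXiv:2105.13159 — 2 statements merged into one kernel-verified Lean document; each statement's English description precedes it below -/
import Mathlib

section
/- For every κ ∈ {1,…,N−1} and every initial condition x̄ ∈ (ℝ^n)^N, the topological bounded-confidence model ẋ = f^t(x) admits a Krasovsky solution defined on the whole interval [0, +∞) with x(0) = x̄. -/
open MeasureTheory Set Filter
open scoped Pointwise

noncomputable section

/-- The state space of `N` agents with opinions in `ℝ^n`. -/
abbrev St (n N : ℕ) := Fin N → EuclideanSpace ℝ (Fin n)

/-- The Krasovsky multifunction of a vector field `g`:
`K g (x) = ⋂_{δ>0} closure (convexHull (g '' B(x,δ)))`. -/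
def krasovsky {E : Type*} [NormedAddCommGroup E] [NormedSpace ℝ E] (g : E → E) (x : E) :
    Set E :=
  ⋂ δ > (0:ℝ), closure (convexHull ℝ (g '' Metric.ball x δ))

/-- Krasovsky solution of `ẋ = g(x)` on the set `D`: an absolutely continuous curve
(written in integral form) whose a.e. derivative `v` satisfies `v(s) ∈ K g (x(s))`. -/
def IsKrasovskySolutionOn {E : Type*} [NormedAddCommGroup E] [NormedSpace ℝ E]
    [CompleteSpace E] (g : E → E) (x : ℝ → E) (D : Set ℝ) : Prop :=
  ∃ v : ℝ → E, LocallyIntegrableOn v D ∧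
    (∀ t ∈ D, x t = x 0 + ∫ s in Ioc (0:ℝ) t, v s) ∧
    (∀ᵐ s ∂(volume.restrict D), v s ∈ krasovsky g (x s))

/-- The set of the first `κ` elements of `{1,…,N} \ {i}` ordered by increasing distance
`‖x_j - x_i‖`, ties broken in favour of lower indices: `j` belongs to the set iff the
number of agents `k ≠ i` strictly preceding `j` in this order is `< κ`. -/
def topoNbrs {n N : ℕ} (κ : ℕ) (x : St n N) (i : Fin N) : Finset (Fin N) :=
  Finset.univ.filter fun j => j ≠ i ∧
    (Finset.univ.filter fun k => k ≠ i ∧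
      (‖x k - x i‖ < ‖x j - x i‖ ∨ (‖x k - x i‖ = ‖x j - x i‖ ∧ k < j))).card < κ

/-- The topological bounded-confidence vector field:
`fᵗᵢ(x) = Σ_{j ∈ Nᵢᵗ(x)} a(‖x_j - x_i‖)(x_j - x_i)`. -/
def ft {n N : ℕ} (a : ℝ → ℝ) (κ : ℕ) (x : St n N) : St n N :=
  fun i => ∑ j ∈ topoNbrs κ x i, a ‖x j - x i‖ • (x j - x i)

open scoped Topology

section Euler

variable {E : Type*} [NormedAddCommGroup E] [NormedSpace ℝ E]

/-- The mean increment of an Euler polygon lies in any convex set containing the vector field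
along the polygon. -/
lemma euler_mean_mem_of_convex {g : E → E} {X : ℕ → E} {h : ℝ} (hh : 0 < h)
    (hX : ∀ m, X (m + 1) = X m + h • g (X m)) {C : Set E} (hC : Convex ℝ C) {m p : ℕ}
    (hmp : m < p) (hg : ∀ j, m ≤ j → j < p → g (X j) ∈ C) :
    (h * p - h * m)⁻¹ • (X p - X m) ∈ C := by
  have hsum : X p - X m = ∑ j ∈ Finset.Ico m p, h • g (X j) := by
    rw [← Finset.sum_Ico_sub X hmp.le]
    exact Finset.sum_congr rfl fun j _ => by rw [hX]; abel
  have hpm : (0 : ℝ) < p - m := sub_pos.2 (by exact_mod_cast hmp)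
  rw [hsum, Finset.smul_sum]
  simp_rw [smul_smul]
  refine hC.sum_mem (fun j _ => ?_) ?_ fun j hj => ?_
  · rw [← mul_sub]; positivity
  · rw [Finset.sum_const, Nat.card_Ico, nsmul_eq_mul, Nat.cast_sub hmp.le, ← mul_sub]
    field_simp
  · rw [Finset.mem_Ico] at hj
    exact hg j hj.1 hj.2

lemma euler_norm_sub_le {g : E → E} {X : ℕ → E} {h M : ℝ} (hh : 0 < h)
    (hX : ∀ m, X (m + 1) = X m + h • g (X m)) (hM : ∀ m, ‖g (X m)‖ ≤ M) {m p : ℕ}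
    (hmp : m ≤ p) : ‖X p - X m‖ ≤ M * (h * p - h * m) := by
  rcases hmp.eq_or_lt with rfl | hlt
  · simp
  have hmem := euler_mean_mem_of_convex hh hX (convex_closedBall (0 : E) M) hlt
    fun j _ _ => by simpa using hM j
  have hpm : (0 : ℝ) < h * p - h * m := by
    rw [← mul_sub]
    exact mul_pos hh (sub_pos.2 (by exact_mod_cast hlt))
  rw [mem_closedBall_zero_iff, norm_smul, norm_inv, Real.norm_of_nonneg hpm.le,
    inv_mul_le_iff₀ hpm] at hmem
  linarith

lemma tendsto_mul_natFloor_div {ι : Type*} {l : Filter ι} {h : ι → ℝ} (hpos : ∀ k, 0 < h k)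
    (hh : Tendsto h l (𝓝 0)) (t : ℝ) :
    Tendsto (fun k => h k * (⌊t / h k⌋₊ : ℝ)) l (𝓝 (max t 0)) := by
  rcases le_total t 0 with ht | ht
  · rw [max_eq_right ht]
    refine tendsto_const_nhds.congr fun k => ?_
    rw [Nat.floor_of_nonpos (div_nonpos_of_nonpos_of_nonneg ht (hpos k).le)]
    simp
  · rw [max_eq_left ht]
    refine tendsto_of_tendsto_of_tendsto_of_le_of_le (g := fun k => t - h k) (h := fun _ => t)
      (by simpa using tendsto_const_nhds.sub hh) tendsto_const_nhds (fun k => ?_) fun k => ?_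
    · have := (div_lt_iff₀ (hpos k)).1 (Nat.lt_floor_add_one (t / h k))
      dsimp only
      linarith
    · have := (le_div_iff₀ (hpos k)).1 (Nat.floor_le (div_nonneg ht (hpos k).le))
      dsimp only
      linarith

/-- A pointwise limit of Euler polygons with vanishing step is Lipschitz, and its derivatives at
nonnegative times belong to the Krasovsky multifunction. -/
lemma exists_lipschitz_deriv_mem_krasovsky {g : E → E} {S : Set E} (hS : IsCompact S) {M : NNReal}
    (hM : ∀ y ∈ S, ‖g y‖ ≤ M) {h₀ : ℝ} (hh₀ : 0 < h₀)
    (hinv : ∀ y ∈ S, ∀ h, 0 < h → h ≤ h₀ → y + h • g y ∈ S) {x₀ : E} (hx₀ : x₀ ∈ S) :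
    ∃ x : ℝ → E, x 0 = x₀ ∧ LipschitzWith M x ∧
      ∀ s v, 0 ≤ s → HasDerivAt x v s → v ∈ krasovsky g (x s) := by
  set h : ℕ → ℝ := fun k => h₀ / (k + 1) with hdef
  have hpos : ∀ k, 0 < h k := fun k => by positivity
  have hle : ∀ k, h k ≤ h₀ := fun k => div_le_self hh₀.le (by simp)
  have hU : (hyperfilter ℕ : Filter ℕ) ≤ atTop := Nat.hyperfilter_le_atTop
  have hlim : Tendsto h (hyperfilter ℕ : Filter ℕ) (𝓝 0) := by
    have := (tendsto_one_div_add_atTop_nhds_zero_nat (𝕜 := ℝ)).const_mul h₀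
    simp only [mul_one_div, mul_zero] at this
    exact this.mono_left hU
  have hT := tendsto_mul_natFloor_div hpos hlim
  set X : ℕ → ℕ → E := fun k m => (fun y => y + h k • g y)^[m] x₀ with hXdef
  have hX : ∀ k m, X k (m + 1) = X k m + h k • g (X k m) := fun k m =>
    Function.iterate_succ_apply' _ _ _
  have hXS : ∀ k m, X k m ∈ S := by
    intro k m
    induction m with
    | zero => exact hx₀
    | succ m ih => rw [hX]; exact hinv _ ih _ (hpos k) (hle k)
  have hXM : ∀ k m, ‖g (X k m)‖ ≤ M := fun k m => hM _ (hXS k m)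
  have hex : ∀ t : ℝ, ∃ z ∈ S,
      Tendsto (fun k => X k ⌊t / h k⌋₊) (hyperfilter ℕ : Filter ℕ) (𝓝 z) := by
    intro t
    exact hS.ultrafilter_le_nhds ((hyperfilter ℕ).map fun k => X k ⌊t / h k⌋₊)
      (le_principal_iff.2 (Filter.mem_map.2 (Filter.univ_mem' fun k => hXS k _)))
  choose x _ hx using hex
  have hfloor : ∀ {s t : ℝ}, s ≤ t → ∀ k, ⌊s / h k⌋₊ ≤ ⌊t / h k⌋₊ := fun hst k =>
    Nat.floor_mono (div_le_div_of_nonneg_right hst (hpos k).le)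
  refine ⟨x, ?_, ?_, ?_⟩
  · refine tendsto_nhds_unique (hx 0) (tendsto_const_nhds.congr fun k => ?_)
    simp [hXdef]
  · have key : ∀ s t : ℝ, s ≤ t → ‖x t - x s‖ ≤ M * (t - s) := by
      intro s t hst
      have h1 : ‖x t - x s‖ ≤ M * (max t 0 - max s 0) :=
        le_of_tendsto_of_tendsto ((hx t).sub (hx s)).norm
          (((hT t).sub (hT s)).const_mul (M : ℝ))
          (Eventually.of_forall fun k =>
            euler_norm_sub_le (hpos k) (hX k) (hXM k) (hfloor hst k))
      refine h1.trans (mul_le_mul_of_nonneg_left ?_ M.2)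
      have := max_sub_max_le_max t 0 s 0
      simpa [hst] using this
    refine LipschitzWith.of_dist_le_mul fun s t => ?_
    rw [dist_eq_norm, Real.dist_eq]
    rcases le_total s t with hst | hst
    · rw [norm_sub_rev, abs_sub_comm, abs_of_nonneg (sub_nonneg.2 hst)]
      exact key s t hst
    · rw [abs_of_nonneg (sub_nonneg.2 hst)]
      exact key t s hst
  · intro s v hs hv
    refine mem_iInter₂.2 fun δ hδ => ?_
    have hslope := (hasDerivAt_iff_tendsto_slope.1 hv).mono_left
      (nhdsWithin_mono s (fun t (ht : s < t) => ht.ne') : 𝓝[>] s ≤ 𝓝[≠] s)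
    refine isClosed_closure.mem_of_tendsto hslope ?_
    have hsmall : ∀ᶠ t in 𝓝[>] s, M * (t - s) < δ := by
      refine (Tendsto.eventually_lt_const (v := M * (s - s)) (by simpa using hδ) ?_).filter_mono
        nhdsWithin_le_nhds
      exact Continuous.tendsto (by fun_prop) s
    filter_upwards [hsmall, self_mem_nhdsWithin] with t htδ (hst : s < t)
    have hTT : Tendsto (fun k => h k * (⌊t / h k⌋₊ : ℝ) - h k * (⌊s / h k⌋₊ : ℝ))
        (hyperfilter ℕ : Filter ℕ) (𝓝 (t - s)) := by
      have := (hT t).sub (hT s)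
      rwa [max_eq_left hs, max_eq_left (hs.trans hst.le)] at this
    rw [slope_def_module]
    refine isClosed_closure.mem_of_tendsto
      ((hTT.inv₀ (sub_pos.2 hst).ne').smul ((hx t).sub (hx s))) ?_
    have hev : ∀ᶠ k in (hyperfilter ℕ : Filter ℕ),
        M * (h k * (⌊t / h k⌋₊ : ℝ) - h k * (⌊s / h k⌋₊ : ℝ)) +
          ‖X k ⌊s / h k⌋₊ - x s‖ < δ := by
      refine Tendsto.eventually_lt_const (v := M * (t - s) + ‖x s - x s‖) (by simpa using htδ) ?_
      exact (hTT.const_mul _).add ((hx s).sub tendsto_const_nhds).norm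
    filter_upwards [hev, hTT.eventually_const_lt (sub_pos.2 hst)] with k hk hk0
    apply subset_closure
    have hlt : ⌊s / h k⌋₊ < ⌊t / h k⌋₊ := by
      have := lt_of_mul_lt_mul_left (sub_pos.1 hk0) (hpos k).le
      exact_mod_cast this
    refine euler_mean_mem_of_convex (hpos k) (hX k) (convex_convexHull ℝ _) hlt
      fun j hj hjt => subset_convexHull ℝ _ ⟨X k j, ?_, rfl⟩
    rw [mem_ball_iff_norm]
    refine lt_of_le_of_lt ?_ hk
    calc ‖X k j - x s‖ ≤ ‖X k j - X k ⌊s / h k⌋₊‖ + ‖X k ⌊s / h k⌋₊ - x s‖ :=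
          norm_sub_le_norm_sub_add_norm_sub _ _ _
      _ ≤ _ := by
          gcongr
          refine (euler_norm_sub_le (hpos k) (hX k) (hXM k) hj).trans ?_
          have := hpos k
          gcongr

variable [FiniteDimensional ℝ E]

lemma LipschitzWith.integral_deriv_eq_sub [CompleteSpace E] {x : ℝ → E} {K : NNReal}
    (hx : LipschitzWith K x) (s t : ℝ) : ∫ u in s..t, deriv x u = x t - x s := by
  have hint : IntervalIntegrable (deriv x) volume s t := by
    refine (intervalIntegrable_const (c := (K : ℝ))).mono_fun
      (stronglyMeasurable_deriv x).aestronglyMeasurable (Eventually.of_forall fun u => ?_)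
    simpa using norm_deriv_le_of_lipschitz hx
  refine (SeparatingDual.eq_iff_forall_dual_eq (R := ℝ)).2 fun φ => ?_
  rw [← φ.intervalIntegral_comp_comm hint, map_sub]
  have hφ : LipschitzWith (‖φ‖₊ * K) (φ ∘ x) := φ.lipschitz.comp hx
  have := (hφ.lipschitzOnWith (s := uIcc s t)).absolutelyContinuousOnInterval.integral_deriv_eq_sub
  rw [Function.comp_apply, Function.comp_apply] at this
  rw [← this]
  refine intervalIntegral.integral_congr_ae ?_
  filter_upwards [hx.ae_differentiableAt_real] with u hu _
  exact (φ.hasFDerivAt.comp_hasDerivAt u hu.hasDerivAt).deriv.symm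

/-- Existence of global Krasovsky solutions for a vector field bounded on a compact set which is
invariant under all sufficiently short Euler steps. -/
lemma exists_isKrasovskySolutionOn_of_euler_invariant [CompleteSpace E] {g : E → E} {S : Set E}
    (hS : IsCompact S) {M : ℝ} (hM : ∀ y ∈ S, ‖g y‖ ≤ M) {h₀ : ℝ} (hh₀ : 0 < h₀)
    (hinv : ∀ y ∈ S, ∀ h, 0 < h → h ≤ h₀ → y + h • g y ∈ S) {x₀ : E} (hx₀ : x₀ ∈ S) :
    ∃ x : ℝ → E, x 0 = x₀ ∧ IsKrasovskySolutionOn g x (Ici 0) := by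
  obtain ⟨x, hx0, hxL, hxK⟩ := exists_lipschitz_deriv_mem_krasovsky (M := M.toNNReal) hS
    (fun y hy => (hM y hy).trans (Real.le_coe_toNNReal M)) hh₀ hinv hx₀
  refine ⟨x, hx0, deriv x, ?_, fun t ht => ?_, ?_⟩
  · refine LocallyIntegrable.locallyIntegrableOn ?_ _
    refine (locallyIntegrable_const (M.toNNReal : ℝ)).mono
      (stronglyMeasurable_deriv x).aestronglyMeasurable (Eventually.of_forall fun u => ?_)
    exact (norm_deriv_le_of_lipschitz hxL).trans (le_abs_self _)
  · rw [← intervalIntegral.integral_of_le ht, hxL.integral_deriv_eq_sub, add_sub_cancel]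
  · rw [ae_restrict_iff' measurableSet_Ici]
    filter_upwards [hxL.ae_differentiableAt_real] with s hs hs0
    exact hxK s _ hs0 hs.hasDerivAt

end Euler

section TopologicalModel

variable {n N κ : ℕ} {a : ℝ → ℝ}

lemma sum_weights_le_of_norm_le (ha_nonneg : ∀ r : ℝ, 0 ≤ r → 0 ≤ a r)
    (ha_mono : MonotoneOn a (Ici 0)) {R : ℝ} {y : St n N} (hy : ∀ i, ‖y i‖ ≤ R) (i : Fin N) :
    ∑ j ∈ topoNbrs κ y i, a ‖y j - y i‖ ≤ N * a (2 * R) := by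
  have hR : 0 ≤ R := (norm_nonneg _).trans (hy i)
  calc ∑ j ∈ topoNbrs κ y i, a ‖y j - y i‖ ≤ ∑ j, a ‖y j - y i‖ :=
        Finset.sum_le_sum_of_subset_of_nonneg (Finset.subset_univ _)
          fun j _ _ => ha_nonneg _ (norm_nonneg _)
    _ ≤ ∑ _j : Fin N, a (2 * R) := Finset.sum_le_sum fun j _ =>
        ha_mono (norm_nonneg _) (mem_Ici.2 (by positivity))
          ((norm_sub_le _ _).trans (by linarith [hy j, hy i]))
    _ = N * a (2 * R) := by simp

lemma norm_ft_apply_le (ha_nonneg : ∀ r : ℝ, 0 ≤ r → 0 ≤ a r)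
    (ha_mono : MonotoneOn a (Ici 0)) {R : ℝ} {y : St n N} (hy : ∀ i, ‖y i‖ ≤ R) (i : Fin N) :
    ‖ft a κ y i‖ ≤ N * a (2 * R) * (2 * R) := by
  have hR : 0 ≤ R := (norm_nonneg _).trans (hy i)
  calc ‖ft a κ y i‖ ≤ ∑ j ∈ topoNbrs κ y i, a ‖y j - y i‖ * (2 * R) := by
        refine norm_sum_le_of_le _ fun j _ => ?_
        have h0 := ha_nonneg _ (norm_nonneg (y j - y i))
        rw [norm_smul, Real.norm_of_nonneg h0]
        exact mul_le_mul_of_nonneg_left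
          ((norm_sub_le _ _).trans (by linarith [hy j, hy i])) h0
    _ ≤ N * a (2 * R) * (2 * R) := by
        rw [← Finset.sum_mul]
        exact mul_le_mul_of_nonneg_right (sum_weights_le_of_norm_le ha_nonneg ha_mono hy i)
          (by positivity)

/-- A short Euler step replaces each opinion by a convex combination of opinions. -/
lemma norm_euler_step_ft_apply_le (ha_nonneg : ∀ r : ℝ, 0 ≤ r → 0 ≤ a r)
    (ha_mono : MonotoneOn a (Ici 0)) {R : ℝ} {y : St n N} (hy : ∀ i, ‖y i‖ ≤ R) {h : ℝ}
    (hh : 0 ≤ h) (hh1 : h * (N * a (2 * R)) ≤ 1) (i : Fin N) :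
    ‖y i + h • ft a κ y i‖ ≤ R := by
  set A := ∑ j ∈ topoNbrs κ y i, a ‖y j - y i‖ with hA
  have hA1 : h * A ≤ 1 :=
    (mul_le_mul_of_nonneg_left (sum_weights_le_of_norm_le ha_nonneg ha_mono hy i) hh).trans hh1
  have heq : y i + h • ft a κ y i =
      (1 - h * A) • y i + h • ∑ j ∈ topoNbrs κ y i, a ‖y j - y i‖ • y j := by
    simp only [ft, smul_sub, Finset.sum_sub_distrib, ← Finset.sum_smul, ← hA, sub_smul, one_smul,
      smul_smul]
    abel
  have hsum : ‖∑ j ∈ topoNbrs κ y i, a ‖y j - y i‖ • y j‖ ≤ A * R := by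
    rw [hA, Finset.sum_mul]
    refine norm_sum_le_of_le _ fun j _ => ?_
    have h0 := ha_nonneg _ (norm_nonneg (y j - y i))
    rw [norm_smul, Real.norm_of_nonneg h0]
    exact mul_le_mul_of_nonneg_left (hy j) h0
  rw [heq]
  refine (norm_add_le _ _).trans ?_
  rw [norm_smul, norm_smul, Real.norm_of_nonneg hh, Real.norm_of_nonneg (sub_nonneg.2 hA1)]
  have h1 := mul_le_mul_of_nonneg_left (hy i) (sub_nonneg.2 hA1)
  have h2 := mul_le_mul_of_nonneg_left hsum hh
  linarith

end TopologicalModel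

/-- For every `κ ∈ {1,…,N-1}` and every initial condition, the topological
bounded-confidence model admits a global Krasovsky solution on `[0, +∞)`. -/
theorem topological_krasovsky_global_existence (n N κ : ℕ) (hn : 1 ≤ n) (hN : 2 ≤ N)
    (hκ₁ : 1 ≤ κ) (hκ₂ : κ ≤ N - 1) (a : ℝ → ℝ)
    (ha_lip : ∃ K : NNReal, LipschitzOnWith K a (Set.Ici 0))
    (ha_nonneg : ∀ r : ℝ, 0 ≤ r → 0 ≤ a r)
    (ha_pos : ∀ r : ℝ, 0 < r → 0 < a r)
    (ha_mono : MonotoneOn a (Set.Ici 0))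
    (xbar : St n N) :
    ∃ x : ℝ → St n N, x 0 = xbar ∧ IsKrasovskySolutionOn (ft a κ) x (Set.Ici 0) := by
  set R := ‖xbar‖
  have hR : 0 ≤ R := norm_nonneg _
  have hB : 0 ≤ (N : ℝ) * a (2 * R) := mul_nonneg N.cast_nonneg (ha_nonneg _ (by positivity))
  have hmem : ∀ y ∈ Metric.closedBall (0 : St n N) R, ∀ i, ‖y i‖ ≤ R := fun y hy =>
    (pi_norm_le_iff_of_nonneg hR).1 (mem_closedBall_zero_iff.1 hy)
  refine exists_isKrasovskySolutionOn_of_euler_invariant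
    (isCompact_closedBall (0 : St n N) R) (M := N * a (2 * R) * (2 * R))
    (h₀ := (N * a (2 * R) + 1)⁻¹) (fun y hy => ?_) (by positivity) (fun y hy h hh hle => ?_)
    (mem_closedBall_zero_iff.2 le_rfl)
  · exact (pi_norm_le_iff_of_nonneg (by positivity)).2
      (norm_ft_apply_le ha_nonneg ha_mono (hmem y hy))
  · refine mem_closedBall_zero_iff.2 ((pi_norm_le_iff_of_nonneg hR).2 fun i => ?_)
    refine norm_euler_step_ft_apply_le ha_nonneg ha_mono (hmem y hy) hh.le ?_ i
    have := (le_inv_comm₀ hh (by positivity)).1 hle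
    have := mul_le_mul_of_nonneg_left this hh.le
    rw [mul_inv_cancel₀ hh.ne'] at this
    linarith
end
end

section
/- For every initial condition x̄ ∈ (ℝ^n)^N, the metric bounded-confidence model ẋ = f^m(x) admits a Caratheodory solution defined on the whole interval [0, +∞) with x(0) = x̄. -/
open MeasureTheory Set Filter
open scoped Pointwise

noncomputable section

/-- Caratheodory solution of `ẋ = f(x)` on the set `D`: an absolutely continuous curve
satisfying `x(t) = x(0) + ∫_0^t f(x(s)) ds`. -/
def IsCaratheodorySolutionOn {E : Type*} [NormedAddCommGroup E] [NormedSpace ℝ E]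
    [CompleteSpace E] (f : E → E) (x : ℝ → E) (D : Set ℝ) : Prop :=
  LocallyIntegrableOn (fun s => f (x s)) D ∧
    ∀ t ∈ D, x t = x 0 + ∫ s in Ioc (0:ℝ) t, f (x s)

/-- The metric bounded-confidence vector field:
`fᵐᵢ(x) = Σ_{j : ‖x_j - x_i‖ < 1} a(‖x_j - x_i‖)(x_j - x_i)`. -/
def fm {n N : ℕ} (a : ℝ → ℝ) (x : St n N) : St n N :=
  fun i => ∑ j ∈ Finset.univ.filter (fun j => ‖x j - x i‖ < 1),
    a ‖x j - x i‖ • (x j - x i)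

/-- The field obtained from the bounded-confidence one by freezing the interaction graph. -/
def graphField {ι V : Type*} [Fintype ι] [NormedAddCommGroup V] [NormedSpace ℝ V]
    (G : SimpleGraph ι) (a : ℝ → ℝ) (x : ι → V) : ι → V :=
  open Classical in
  fun i => ∑ j ∈ Finset.univ.filter (fun j => G.Adj i j), a ‖x j - x i‖ • (x j - x i)

theorem graphField_apply {ι V : Type*} [Fintype ι] [NormedAddCommGroup V] [NormedSpace ℝ V]
    (G : SimpleGraph ι) [DecidableRel G.Adj] (a : ℝ → ℝ) (x : ι → V) (i : ι) :
    graphField G a x i =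
      ∑ j ∈ Finset.univ.filter (fun j => G.Adj i j), a ‖x j - x i‖ • (x j - x i) := by
  unfold graphField
  congr!

theorem fm_eq_graphField {n N : ℕ} {a : ℝ → ℝ} {x : St n N} {G : SimpleGraph (Fin N)}
    (h : ∀ i j, i ≠ j → (G.Adj i j ↔ ‖x j - x i‖ < 1)) : fm a x = graphField G a x := by
  classical
  funext i
  unfold fm graphField
  rw [Finset.sum_filter, Finset.sum_filter]
  refine Finset.sum_congr rfl fun j _ => ?_
  by_cases hij : i = j
  · subst hij; simp
  · simp [h i j hij]

theorem norm_fm_le {n N : ℕ} {a : ℝ → ℝ} (ha_nonneg : ∀ r : ℝ, 0 ≤ r → 0 ≤ a r)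
    (ha_mono : MonotoneOn a (Ici 0)) (x : St n N) : ‖fm a x‖ ≤ N * a 1 := by
  have h1 : 0 ≤ a 1 := ha_nonneg 1 zero_le_one
  refine (pi_norm_le_iff_of_nonneg (by positivity)).2 fun i => ?_
  unfold fm
  rw [Finset.sum_filter]
  refine (norm_sum_le _ _).trans ?_
  calc ∑ j, ‖if ‖x j - x i‖ < 1 then a ‖x j - x i‖ • (x j - x i) else 0‖
      ≤ ∑ _j : Fin N, a 1 := by
        refine Finset.sum_le_sum fun j _ => ?_
        split_ifs with h
        · rw [norm_smul, Real.norm_of_nonneg (ha_nonneg _ (norm_nonneg _))]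
          have := ha_mono (norm_nonneg (x j - x i)) (zero_le_one' ℝ) h.le
          nlinarith [norm_nonneg (x j - x i), ha_nonneg _ (norm_nonneg (x j - x i))]
        · simpa using h1
    _ = N * a 1 := by simp

theorem norm_smul_radial_sub_le {V : Type*} [NormedAddCommGroup V] [NormedSpace ℝ V]
    {a : ℝ → ℝ} {K : NNReal} (hK : LipschitzOnWith K a (Ici 0))
    (ha_nonneg : ∀ r : ℝ, 0 ≤ r → 0 ≤ a r) (ha_mono : MonotoneOn a (Ici 0)) {R : ℝ} {u v : V}
    (hu : ‖u‖ ≤ R) (hv : ‖v‖ ≤ R) :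
    ‖a ‖u‖ • u - a ‖v‖ • v‖ ≤ (a R + K * R) * ‖u - v‖ := by
  have hR : 0 ≤ R := (norm_nonneg u).trans hu
  have h : a ‖u‖ • u - a ‖v‖ • v = a ‖u‖ • (u - v) + (a ‖u‖ - a ‖v‖) • v := by
    rw [smul_sub, sub_smul]; abel
  have h1 : ‖a ‖u‖ • (u - v)‖ ≤ a R * ‖u - v‖ := by
    rw [norm_smul, Real.norm_of_nonneg (ha_nonneg _ (norm_nonneg _))]
    gcongr
    exact ha_mono (norm_nonneg u) hR hu
  have h2 : ‖(a ‖u‖ - a ‖v‖) • v‖ ≤ (K * ‖u - v‖) * R := by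
    rw [norm_smul]
    gcongr
    have := hK.dist_le_mul ‖u‖ (norm_nonneg u) ‖v‖ (norm_nonneg v)
    rw [Real.dist_eq, Real.dist_eq] at this
    rw [Real.norm_eq_abs]
    refine this.trans ?_
    gcongr
    exact abs_norm_sub_norm_le u v
  rw [h]
  refine (norm_add_le _ _).trans ?_
  linarith

theorem locallyLipschitz_graphField {ι V : Type*} [Fintype ι] [NormedAddCommGroup V]
    [NormedSpace ℝ V] (G : SimpleGraph ι) {a : ℝ → ℝ} {K : NNReal}
    (hK : LipschitzOnWith K a (Ici 0)) (ha_nonneg : ∀ r : ℝ, 0 ≤ r → 0 ≤ a r)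
    (ha_mono : MonotoneOn a (Ici 0)) :
    LocallyLipschitz (graphField G a : (ι → V) → (ι → V)) := by
  classical
  intro p
  set R : ℝ := 2 * (‖p‖ + 1) with hRdef
  have hR : 0 ≤ R := by positivity
  set C : ℝ := Fintype.card ι * ((a R + K * R) * 2) with hC
  have hCR : 0 ≤ a R + K * R := add_nonneg (ha_nonneg R hR) (by positivity)
  refine ⟨C.toNNReal, Metric.closedBall p 1, Metric.closedBall_mem_nhds p one_pos,
    LipschitzOnWith.of_dist_le_mul fun x hx y hy => ?_⟩
  have hC0 : 0 ≤ C := by positivity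
  rw [Real.coe_toNNReal _ hC0, dist_eq_norm, dist_eq_norm]
  have hdiff : ∀ z ∈ Metric.closedBall p 1, ∀ i j, ‖z j - z i‖ ≤ R := by
    intro z hz i j
    have hz' : ‖z‖ ≤ ‖p‖ + 1 := norm_le_of_mem_closedBall hz
    have := norm_sub_le (z j) (z i)
    have := norm_le_pi_norm z i
    have := norm_le_pi_norm z j
    linarith
  refine (pi_norm_le_iff_of_nonneg (by positivity)).2 fun i => ?_
  simp only [Pi.sub_apply, graphField, Finset.sum_filter]
  rw [← Finset.sum_sub_distrib]
  refine (norm_sum_le _ _).trans ?_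
  calc _ ≤ ∑ _j : ι, (a R + K * R) * (2 * ‖x - y‖) := by
        refine Finset.sum_le_sum fun j _ => ?_
        split_ifs
        · refine (norm_smul_radial_sub_le hK ha_nonneg ha_mono
            (hdiff x hx i j) (hdiff y hy i j)).trans ?_
          gcongr
          have h1 := norm_le_pi_norm (x - y) i
          have h2 := norm_le_pi_norm (x - y) j
          have h3 := norm_sub_le ((x - y) j) ((x - y) i)
          have h4 : x j - x i - (y j - y i) = (x - y) j - (x - y) i := by
            simp only [Pi.sub_apply]; abel
          rw [h4]
          linarith
        · simp only [sub_self, norm_zero]; positivity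
    _ = C * ‖x - y‖ := by simp [hC]; ring

theorem graphField_sup_edge {ι V : Type*} [Fintype ι] [DecidableEq ι] [NormedAddCommGroup V]
    [NormedSpace ℝ V] (G : SimpleGraph ι) (a : ℝ → ℝ) (x : ι → V) {p q : ι} (hpq : p ≠ q)
    (h : ¬ G.Adj p q) :
    graphField (G ⊔ SimpleGraph.edge p q) a x = graphField G a x +
      (Pi.single p (a ‖x q - x p‖ • (x q - x p)) - Pi.single q (a ‖x q - x p‖ • (x q - x p))) := by
  classical
  have h' : ¬ G.Adj q p := fun hh => h hh.symm
  funext i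
  simp only [graphField_apply, Pi.add_apply, Pi.sub_apply]
  by_cases hip : i = p
  · subst hip
    have : Finset.univ.filter (fun j => (G ⊔ SimpleGraph.edge i q).Adj i j)
        = insert q (Finset.univ.filter (fun j => G.Adj i j)) := by
      ext j
      simp only [Finset.mem_filter, Finset.mem_univ, true_and, SimpleGraph.sup_adj,
        SimpleGraph.edge_adj, Finset.mem_insert]
      grind
    rw [this, Finset.sum_insert (by simpa using h)]
    simp [hpq, add_comm]
  · by_cases hiq : i = q
    · subst hiq
      have : Finset.univ.filter (fun j => (G ⊔ SimpleGraph.edge p i).Adj i j)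
          = insert p (Finset.univ.filter (fun j => G.Adj i j)) := by
        ext j
        simp only [Finset.mem_filter, Finset.mem_univ, true_and, SimpleGraph.sup_adj,
          SimpleGraph.edge_adj, Finset.mem_insert]
        grind
      rw [this, Finset.sum_insert (by simpa using h')]
      simp only [Pi.single_eq_same, Pi.single_eq_of_ne hip, zero_sub]
      rw [norm_sub_rev (x p), ← smul_neg, neg_sub, add_comm]
    · have : Finset.univ.filter (fun j => (G ⊔ SimpleGraph.edge p q).Adj i j)
          = Finset.univ.filter (fun j => G.Adj i j) := by
        ext j
        simp only [Finset.mem_filter, Finset.mem_univ, true_and, SimpleGraph.sup_adj,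
          SimpleGraph.edge_adj]
        grind
      rw [this]
      simp [hip, hiq]

theorem sum_norm_sq_add_single_sub_single {ι V : Type*} [Fintype ι] [DecidableEq ι]
    [NormedAddCommGroup V] [InnerProductSpace ℝ V] (v : ι → V) {p q : ι} (hpq : p ≠ q) (e : V) :
    ∑ i, ‖(v + (Pi.single p e - Pi.single q e) : ι → V) i‖ ^ 2
      = ∑ i, ‖v i‖ ^ 2 + 2 * inner ℝ (v p - v q) e + 2 * ‖e‖ ^ 2 := by
  have key : ∀ i, ‖(v + (Pi.single p e - Pi.single q e) : ι → V) i‖ ^ 2 = ‖v i‖ ^ 2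
      + ((if i = p then 2 * inner ℝ (v p) e + ‖e‖ ^ 2 else 0)
        + (if i = q then -2 * inner ℝ (v q) e + ‖e‖ ^ 2 else 0)) := by
    intro i
    by_cases hip : i = p
    · subst hip
      simp only [Pi.add_apply, Pi.sub_apply, Pi.single_eq_same, Pi.single_eq_of_ne hpq,
        sub_zero, if_true, if_neg hpq]
      rw [norm_add_sq_real]; ring
    · by_cases hiq : i = q
      · subst hiq
        simp only [Pi.add_apply, Pi.sub_apply, Pi.single_eq_same, Pi.single_eq_of_ne hip,
          zero_sub, if_true, if_neg hip]
        rw [← sub_eq_add_neg, norm_sub_sq_real]; ring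
      · simp [hip, hiq]
  simp_rw [key]
  rw [Finset.sum_add_distrib, Finset.sum_add_distrib, Finset.sum_ite_eq' , Finset.sum_ite_eq']
  simp only [Finset.mem_univ, if_true, inner_sub_left]
  ring

/-- Among the interaction graphs compatible with the configuration `x`, one maximizing the speed
of the corresponding field immediately resolves every pair at distance one. -/
theorem exists_graph_resolving_boundary {ι V : Type*} [Fintype ι] [NormedAddCommGroup V]
    [InnerProductSpace ℝ V] {a : ℝ → ℝ} (ha : 0 < a 1) (x : ι → V) :
    ∃ G : SimpleGraph ι, ∀ i j, i ≠ j →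
      (‖x j - x i‖ < 1 → G.Adj i j) ∧ (1 < ‖x j - x i‖ → ¬ G.Adj i j) ∧
      (‖x j - x i‖ = 1 → G.Adj i j →
        inner ℝ (x j - x i) (graphField G a x j - graphField G a x i) < 0) ∧
      (‖x j - x i‖ = 1 → ¬ G.Adj i j →
        0 < inner ℝ (x j - x i) (graphField G a x j - graphField G a x i)) := by
  classical
  let S : Set (SimpleGraph ι) := {G | ∀ i j, i ≠ j →
    (‖x j - x i‖ < 1 → G.Adj i j) ∧ (1 < ‖x j - x i‖ → ¬ G.Adj i j)}
  have hS : S.Nonempty := by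
    refine ⟨SimpleGraph.mk (fun i j => i ≠ j ∧ ‖x j - x i‖ < 1)
      ⟨fun i j h => ⟨h.1.symm, by rw [norm_sub_rev]; exact h.2⟩⟩ ⟨fun i h => h.1 rfl⟩, ?_⟩
    intro i j hij
    exact ⟨fun h => ⟨hij, h⟩, fun h h' => lt_asymm h h'.2⟩
  obtain ⟨G, hG, hmax⟩ := Set.exists_max_image S
    (fun G => ∑ i, ‖graphField G a x i‖ ^ 2) S.toFinite hS
  have hinner : ∀ i j : ι, ∀ v : ι → V,
      inner ℝ (v i - v j) (x j - x i) = - inner ℝ (x j - x i) (v j - v i) := by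
    intro i j v
    rw [real_inner_comm, ← neg_sub (v j), inner_neg_right]
  refine ⟨G, fun i j hij => ⟨(hG i j hij).1, (hG i j hij).2, fun h1 hadj => ?_, fun h1 hadj => ?_⟩⟩
  · set G' := G \ SimpleGraph.edge i j with hG'
    have hsup : G' ⊔ SimpleGraph.edge i j = G :=
      sdiff_sup_cancel ((SimpleGraph.edge_le_iff G).2 (Or.inr hadj))
    have hmem : G' ∈ S := by
      intro k l hkl
      have := hG k l hkl
      simp only [hG', SimpleGraph.sdiff_adj, SimpleGraph.edge_adj]
      refine ⟨fun h => ⟨this.1 h, ?_⟩, fun h h' => this.2 h h'.1⟩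
      rintro ⟨⟨rfl, rfl⟩ | ⟨rfl, rfl⟩, -⟩
      · exact h.ne h1
      · rw [norm_sub_rev] at h; exact h.ne h1
    have hle := hmax G' hmem
    have hnadj : ¬ G'.Adj i j := by
      simp [hG', SimpleGraph.edge_adj, hij]
    have hF := graphField_sup_edge G' a x hij hnadj
    rw [hsup, h1] at hF
    have hF' : graphField G' a x = graphField G a x +
        (Pi.single i (-(a 1 • (x j - x i))) - Pi.single j (-(a 1 • (x j - x i)))) := by
      rw [hF, Pi.single_neg, Pi.single_neg]; abel
    simp only [hF'] at hle
    rw [sum_norm_sq_add_single_sub_single _ hij, inner_neg_right, inner_smul_right, hinner,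
      norm_neg, norm_smul, h1, Real.norm_of_nonneg ha.le] at hle
    nlinarith
  · set G' := G ⊔ SimpleGraph.edge i j with hG'
    have hmem : G' ∈ S := by
      intro k l hkl
      have := hG k l hkl
      simp only [hG', SimpleGraph.sup_adj, SimpleGraph.edge_adj]
      refine ⟨fun h => Or.inl (this.1 h), fun h => ?_⟩
      rintro (h' | ⟨⟨rfl, rfl⟩ | ⟨rfl, rfl⟩, -⟩)
      · exact this.2 h h'
      · exact h.ne' h1
      · rw [norm_sub_rev] at h; exact h.ne' h1
    have hle := hmax G' hmem
    have hF := graphField_sup_edge G a x hij hadj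
    rw [← hG', h1] at hF
    simp only [hF] at hle
    rw [sum_norm_sq_add_single_sub_single _ hij, inner_smul_right, hinner,
      norm_smul, h1, Real.norm_of_nonneg ha.le] at hle
    nlinarith

theorem LocallyLipschitz.exists_forall_mem_Ioo_hasDerivAt {E : Type*} [NormedAddCommGroup E]
    [NormedSpace ℝ E] [CompleteSpace E] {f : E → E} (hf : LocallyLipschitz f) (p : E) :
    ∃ y : ℝ → E, y 0 = p ∧ ∃ ε > 0, ∀ t ∈ Ioo (-ε) ε, HasDerivAt y (f (y t)) t := by
  obtain ⟨K, s, hs, hl⟩ := hf p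
  obtain ⟨r, hr, hrs⟩ := Metric.nhds_basis_closedBall.mem_iff.1 hs
  have hlr := hl.mono hrs
  set L : ℝ := ‖f p‖ + K * r + 1 with hL
  have hL0 : 0 < L := by positivity
  have hε : 0 < r / L := by positivity
  have hpl : IsPicardLindelof (fun _ => f) (tmin := -(r / L)) (tmax := r / L)
      ⟨0, by constructor <;> linarith⟩ p ⟨r, hr.le⟩ 0 ⟨L, hL0.le⟩ K := by
    refine IsPicardLindelof.of_time_independent (fun x hx => ?_) hlr ?_
    · have h1 := hlr.dist_le_mul x hx p (Metric.mem_closedBall_self hr.le)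
      rw [dist_eq_norm] at h1
      have h2 : (K : ℝ) * dist x p ≤ K * r := by gcongr; exact hx
      have h3 := norm_le_norm_add_norm_sub' (f x) (f p)
      change ‖f x‖ ≤ L
      linarith
    · change L * max (r / L - 0) (0 - -(r / L)) ≤ r - 0
      simp only [sub_zero, zero_sub, neg_neg, max_self]
      rw [mul_div_cancel₀ _ hL0.ne']
  obtain ⟨y, hy0, hy⟩ := hpl.exists_eq_forall_mem_Icc_hasDerivWithinAt₀
  exact ⟨y, hy0, r / L, hε, fun t ht =>
    (hy t (Ioo_subset_Icc_self ht)).hasDerivAt (Icc_mem_nhds ht.1 ht.2)⟩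

theorem HasDerivAt.eventually_lt_nhdsGT {h : ℝ → ℝ} {h' t : ℝ} (hd : HasDerivAt h h' t)
    (hpos : 0 < h') : ∀ᶠ s in nhdsWithin t (Ioi t), h t < h s := by
  have hs := (hasDerivWithinAt_iff_tendsto_slope' (s := Ioi t) (by simp)).1 hd.hasDerivWithinAt
  filter_upwards [hs.eventually_const_lt hpos, self_mem_nhdsWithin] with s h1 h2
  exact (slope_pos_iff_of_le (le_of_lt h2)).1 h1

theorem exists_local_solution_fm {n N : ℕ} {a : ℝ → ℝ} {K : NNReal}
    (hK : LipschitzOnWith K a (Ici 0)) (ha_nonneg : ∀ r : ℝ, 0 ≤ r → 0 ≤ a r)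
    (ha : 0 < a 1) (ha_mono : MonotoneOn a (Ici 0)) (p : St n N) :
    ∃ ε > 0, ∃ y : ℝ → St n N, y 0 = p ∧ ∀ t ∈ Icc 0 ε,
      IntervalIntegrable (fun s => fm a (y s)) volume 0 t ∧
      y t = p + ∫ s in (0 : ℝ)..t, fm a (y s) := by
  obtain ⟨G, hG⟩ := exists_graph_resolving_boundary ha p
  have hLip : LocallyLipschitz (graphField G a : St n N → St n N) :=
    locallyLipschitz_graphField G hK ha_nonneg ha_mono
  obtain ⟨y, hy0, δ, hδ, hy⟩ := hLip.exists_forall_mem_Ioo_hasDerivAt p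
  have hd0 := hy 0 ⟨by linarith, hδ⟩
  rw [hy0] at hd0
  have hev : ∀ᶠ t in nhdsWithin (0 : ℝ) (Ioi 0), ∀ i j, i ≠ j →
      (G.Adj i j ↔ ‖y t j - y t i‖ < 1) := by
    refine eventually_all.2 fun i => eventually_all.2 fun j => ?_
    by_cases hij : i = j
    · exact Eventually.of_forall fun t h => absurd hij h
    obtain ⟨h1, h2, h3, h4⟩ := hG i j hij
    have hdi : ∀ k, HasDerivAt (fun t => y t k) (graphField G a p k) 0 := hasDerivAt_pi.1 hd0
    have hdiff := (hdi j).sub (hdi i)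
    have hcont : Tendsto (fun t => ‖y t j - y t i‖) (nhdsWithin 0 (Ioi 0))
        (nhds ‖p j - p i‖) := by
      have := hdiff.continuousAt.norm.tendsto.mono_left (nhdsWithin_le_nhds (s := Ioi 0))
      simpa [hy0] using this
    have hsq := hdiff.norm_sq
    rcases lt_trichotomy ‖p j - p i‖ 1 with hlt | heq | hgt
    · filter_upwards [hcont.eventually_lt_const hlt] with t ht _
      exact iff_of_true (h1 hlt) ht
    · by_cases hadj : G.Adj i j
      · have hneg := h3 heq hadj
        filter_upwards [hsq.neg.eventually_lt_nhdsGT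
          (by simp only [Pi.sub_apply, hy0]; linarith)] with t ht _
        refine iff_of_true hadj ?_
        simp only [Pi.neg_apply, Pi.sub_apply, hy0, heq] at ht
        nlinarith [norm_nonneg (y t j - y t i)]
      · have hpos := h4 heq hadj
        filter_upwards [hsq.eventually_lt_nhdsGT
          (by simp only [Pi.sub_apply, hy0]; linarith)] with t ht _
        refine iff_of_false hadj ?_
        simp only [Pi.sub_apply, hy0, heq] at ht
        nlinarith [norm_nonneg (y t j - y t i)]
    · filter_upwards [hcont.eventually_const_lt hgt] with t ht _
      exact iff_of_false (h2 hgt) ht.not_gt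
  obtain ⟨η, hη, hηs⟩ := mem_nhdsGT_iff_exists_Ioc_subset.1 hev
  have hη' : (0 : ℝ) < η := hη
  refine ⟨min η (δ / 2), by positivity, y, hy0, fun t ht => ?_⟩
  have hsub : Icc 0 t ⊆ Ioo (-δ) δ := fun s hs =>
    ⟨by linarith [hs.1], by linarith [hs.2, ht.2, min_le_right η (δ / 2)]⟩
  have hcongr : EqOn (fun s => graphField G a (y s)) (fun s => fm a (y s)) (uIoo 0 t) := by
    rw [uIoo_of_le ht.1]
    intro s hs
    exact (fm_eq_graphField (hηs ⟨hs.1, hs.2.le.trans (ht.2.trans (min_le_left _ _))⟩)).symm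
  have hint : IntervalIntegrable (fun s => graphField G a (y s)) volume 0 t := by
    refine ContinuousOn.intervalIntegrable ?_
    rw [uIcc_of_le ht.1]
    exact hLip.continuous.comp_continuousOn
      fun s hs => (hy s (hsub hs)).continuousAt.continuousWithinAt
  refine ⟨hint.congr_uIoo hcongr, ?_⟩
  rw [← intervalIntegral.integral_congr_uIoo hcongr,
    intervalIntegral.integral_eq_sub_of_hasDerivAt
      (fun s hs => hy s (hsub (by rwa [uIcc_of_le ht.1] at hs))) hint, hy0]
  abel

/-- The curve `x` solves the integral equation of `ẋ = f(x)` with `x(0) = p` on the initial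
segment `D` of `[0, ∞)`. -/
structure IsPartialSolution {E : Type*} [NormedAddCommGroup E] [NormedSpace ℝ E]
    (f : E → E) (p : E) (D : Set ℝ) (x : ℝ → E) : Prop where
  zero_mem : 0 ∈ D
  subset : D ⊆ Ici 0
  Icc_subset : ∀ t ∈ D, Icc 0 t ⊆ D
  intervalIntegrable : ∀ t ∈ D, IntervalIntegrable (fun s => f (x s)) volume 0 t
  eq_integral : ∀ t ∈ D, x t = p + ∫ s in (0 : ℝ)..t, f (x s)

theorem isPartialSolution_singleton_zero {E : Type*} [NormedAddCommGroup E] [NormedSpace ℝ E]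
    (f : E → E) (p : E) : IsPartialSolution f p {0} (fun _ => p) where
  zero_mem := rfl
  subset := by simp
  Icc_subset := fun t ht => by rw [mem_singleton_iff.1 ht, Icc_self]
  intervalIntegrable := by simp
  eq_integral := by simp

theorem IsPartialSolution.exists_extension {E : Type*} [NormedAddCommGroup E] [NormedSpace ℝ E]
    {f : E → E} {M : ℝ} (hM : ∀ x, ‖f x‖ ≤ M)
    (hloc : ∀ p, ∃ ε > 0, ∃ y : ℝ → E, y 0 = p ∧ ∀ t ∈ Icc 0 ε,
      IntervalIntegrable (fun s => f (y s)) volume 0 t ∧ y t = p + ∫ s in (0 : ℝ)..t, f (y s))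
    {p : E} {D : Set ℝ} {x : ℝ → E} (hx : IsPartialSolution f p D x) (hD : D ≠ Ici 0) :
    ∃ D' z, IsPartialSolution f p D' z ∧ D ⊆ D' ∧ EqOn x z D ∧ ¬ D' ⊆ D := by
  obtain ⟨b, hb0, hbD⟩ : ∃ b, 0 ≤ b ∧ b ∉ D := by
    by_contra! h
    exact hD (hx.subset.antisymm h)
  have hbdd : BddAbove D := by
    refine ⟨b, fun t ht => ?_⟩
    by_contra! h
    exact hbD (hx.Icc_subset t ht ⟨hb0, h.le⟩)
  set T := sSup D with hT
  have hT0 : 0 ≤ T := le_csSup hbdd hx.zero_mem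
  have hlt : ∀ s, 0 ≤ s → s < T → s ∈ D := by
    intro s hs hsT
    obtain ⟨t, ht, hst⟩ := exists_lt_of_lt_csSup ⟨0, hx.zero_mem⟩ hsT
    exact hx.Icc_subset t ht ⟨hs, hst.le⟩
  have hint : IntervalIntegrable (fun s => f (x s)) volume 0 T := by
    rw [intervalIntegrable_iff_integrableOn_Ioo_of_le hT0]
    refine IntegrableOn.of_bound (by simp) ?_ M (Eventually.of_forall fun s => hM _)
    obtain ⟨u, -, huT, hu⟩ := exists_seq_strictMono_tendsto T
    have hsub : Ioo 0 T ⊆ ⋃ n, Ioc 0 (u n) := by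
      intro s hs
      obtain ⟨n, hn⟩ := (hu.eventually_const_lt hs.2).exists
      exact mem_iUnion.2 ⟨n, hs.1, hn.le⟩
    refine AEStronglyMeasurable.mono_set hsub (aestronglyMeasurable_iUnion_iff.2 fun n => ?_)
    rcases le_total 0 (u n) with h0 | h0
    · exact ((intervalIntegrable_iff_integrableOn_Ioc_of_le h0).1
        (hx.intervalIntegrable _ (hlt _ h0 (huT n)))).aestronglyMeasurable
    · simp [Ioc_eq_empty_of_le h0]
  obtain ⟨ε, hε, y, hy0, hy⟩ := hloc (p + ∫ s in (0 : ℝ)..T, f (x s))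
  set z : ℝ → E := fun t => if t < T then x t else y (t - T) with hz
  have hzlt : ∀ t, t < T → z t = x t := fun t ht => if_pos ht
  have hzge : ∀ t, T ≤ t → z t = y (t - T) := fun t ht => if_neg ht.not_gt
  have hcongr : ∀ t, 0 ≤ t → t ≤ T →
      EqOn (fun s => f (x s)) (fun s => f (z s)) (uIoo 0 t) := by
    intro t ht htT s hs
    rw [uIoo_of_le ht] at hs
    simp only [hzlt s (hs.2.trans_le htT)]
  have hintT : IntervalIntegrable (fun s => f (z s)) volume 0 T :=
    hint.congr_uIoo (hcongr T hT0 le_rfl)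
  have hcongr' : ∀ t, T ≤ t →
      EqOn (fun s => f (y (s - T))) (fun s => f (z s)) (uIoo T t) := by
    intro t ht s hs
    rw [uIoo_of_le ht] at hs
    simp only [hzge s hs.1.le]
  have hint' : ∀ t ∈ Icc T (T + ε), IntervalIntegrable (fun s => f (z s)) volume T t := by
    intro t ht
    have h := (hy (t - T) ⟨by linarith [ht.1], by linarith [ht.2]⟩).1.comp_sub_right T
    rw [zero_add, sub_add_cancel] at h
    exact h.congr_uIoo (hcongr' t ht.1)
  refine ⟨Icc 0 (T + ε), z, ⟨⟨le_rfl, by linarith⟩, fun t ht => ht.1,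
    fun t ht => Icc_subset_Icc_right ht.2, fun t ht => ?_, fun t ht => ?_⟩,
    fun t ht => ⟨hx.subset ht, by linarith [le_csSup hbdd ht]⟩, fun t ht => ?_, fun h => ?_⟩
  · rcases lt_or_ge t T with h | h
    · exact (hx.intervalIntegrable t (hlt t ht.1 h)).congr_uIoo (hcongr t ht.1 h.le)
    · exact hintT.trans (hint' t ⟨h, ht.2⟩)
  · rcases lt_or_ge t T with h | h
    · rw [hzlt t h, hx.eq_integral t (hlt t ht.1 h),
        intervalIntegral.integral_congr_uIoo (hcongr t ht.1 h.le)]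
    · rw [hzge t h, (hy (t - T) ⟨by linarith, by linarith [ht.2]⟩).2,
        ← intervalIntegral.integral_add_adjacent_intervals hintT (hint' t ⟨h, ht.2⟩),
        ← intervalIntegral.integral_congr_uIoo (hcongr T hT0 le_rfl),
        ← intervalIntegral.integral_congr_uIoo (hcongr' t h),
        intervalIntegral.integral_comp_sub_right (fun s => f (y s)), sub_self, add_assoc]
  · rcases (le_csSup hbdd ht).lt_or_eq with h | h
    · exact (hzlt t h).symm
    · rw [hzge t h.ge, hx.eq_integral t ht, h, ← hT, sub_self, hy0]
  · have := le_csSup hbdd (h ⟨by linarith, le_rfl⟩)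
    linarith

/-- A bounded field admitting local Caratheodory solutions from every point admits global ones. -/
theorem exists_isPartialSolution_Ici {E : Type*} [NormedAddCommGroup E] [NormedSpace ℝ E]
    {f : E → E} {M : ℝ} (hM : ∀ x, ‖f x‖ ≤ M)
    (hloc : ∀ p, ∃ ε > 0, ∃ y : ℝ → E, y 0 = p ∧ ∀ t ∈ Icc 0 ε,
      IntervalIntegrable (fun s => f (y s)) volume 0 t ∧ y t = p + ∫ s in (0 : ℝ)..t, f (y s))
    (p : E) : ∃ x, IsPartialSolution f p (Ici 0) x := by
  let r : {s : Set ℝ × (ℝ → E) // IsPartialSolution f p s.1 s.2} →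
      {s : Set ℝ × (ℝ → E) // IsPartialSolution f p s.1 s.2} → Prop :=
    fun s t => s.1.1 ⊆ t.1.1 ∧ EqOn s.1.2 t.1.2 s.1.1
  have : Nonempty {s : Set ℝ × (ℝ → E) // IsPartialSolution f p s.1 s.2} :=
    ⟨⟨({0}, fun _ => p), isPartialSolution_singleton_zero f p⟩⟩
  obtain ⟨⟨⟨D, x⟩, hx⟩, hmax⟩ := exists_maximal_of_nonempty_chains_bounded (r := r) (by
    intro c hc hne
    classical
    let z : ℝ → E := fun t => if h : ∃ s ∈ c, t ∈ s.1.1 then h.choose.1.2 t else p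
    have hz : ∀ s ∈ c, EqOn s.1.2 z s.1.1 := by
      intro s hs t ht
      have h : ∃ s ∈ c, t ∈ s.1.1 := ⟨s, hs, ht⟩
      have hzt : z t = h.choose.1.2 t := dif_pos h
      rw [hzt]
      have hmem := h.choose_spec.2
      by_cases heq : s = h.choose
      · rw [← heq]
      rcases hc hs h.choose_spec.1 heq with h' | h'
      · exact h'.2 ht
      · exact (h'.2 hmem).symm
    have hcongr : ∀ s ∈ c, ∀ t ∈ s.1.1,
        EqOn (fun u => f (s.1.2 u)) (fun u => f (z u)) (uIoo 0 t) := by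
      intro s hs t ht u hu
      rw [uIoo_of_le (s.2.subset ht)] at hu
      simp only [hz s hs (s.2.Icc_subset t ht (Ioo_subset_Icc_self hu))]
    obtain ⟨s₀, hs₀⟩ := hne
    refine ⟨⟨(⋃ s ∈ c, s.1.1, z), ⟨mem_biUnion hs₀ s₀.2.zero_mem,
      iUnion₂_subset fun s _ => s.2.subset, fun t ht => ?_, fun t ht => ?_, fun t ht => ?_⟩⟩,
      fun s hs => ⟨subset_biUnion_of_mem (u := fun s => s.1.1) hs, hz s hs⟩⟩ <;>
      obtain ⟨s, hs, hts⟩ := mem_iUnion₂.1 ht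
    · exact (s.2.Icc_subset t hts).trans (subset_biUnion_of_mem (u := fun s => s.1.1) hs)
    · exact (s.2.intervalIntegrable t hts).congr_uIoo (hcongr s hs t hts)
    · change z t = _
      rw [← hz s hs hts, s.2.eq_integral t hts,
        intervalIntegral.integral_congr_uIoo (hcongr s hs t hts)])
    (fun h1 h2 => ⟨h1.1.trans h2.1, fun t ht => (h1.2 ht).trans (h2.2 (h1.1 ht))⟩)
  by_cases hD : D = Ici 0
  · exact ⟨x, hD ▸ hx⟩
  · obtain ⟨D', z, hz, hsub, heq, hnot⟩ := IsPartialSolution.exists_extension hM hloc hx hD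
    exact absurd (hmax ⟨(D', z), hz⟩ ⟨hsub, heq⟩).1 hnot

theorem IsPartialSolution.isCaratheodorySolutionOn {E : Type*} [NormedAddCommGroup E]
    [NormedSpace ℝ E] [CompleteSpace E] {f : E → E} {p : E} {x : ℝ → E}
    (hx : IsPartialSolution f p (Ici 0) x) :
    x 0 = p ∧ IsCaratheodorySolutionOn f x (Ici 0) := by
  have hx0 : x 0 = p := by simpa using hx.eq_integral 0 hx.zero_mem
  refine ⟨hx0, fun t ht => ⟨Icc 0 (t + 1), ?_, ?_⟩, fun t ht => ?_⟩
  · rw [← Ici_inter_Iic]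
    exact inter_mem_nhdsWithin _ (Iic_mem_nhds (lt_add_one t))
  · have h1 : (0 : ℝ) ≤ t + 1 := add_nonneg ht zero_le_one
    rw [integrableOn_Icc_iff_integrableOn_Ioc]
    exact (intervalIntegrable_iff_integrableOn_Ioc_of_le h1).1 (hx.intervalIntegrable _ h1)
  · rw [hx0, ← intervalIntegral.integral_of_le ht]
    exact hx.eq_integral t ht

/-- For every initial condition, the metric bounded-confidence model admits a global
Caratheodory solution on `[0, +∞)`. -/
theorem metric_caratheodory_global_existence (n N : ℕ) (hn : 1 ≤ n) (hN : 1 ≤ N)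
    (a : ℝ → ℝ)
    (ha_lip : ∃ K : NNReal, LipschitzOnWith K a (Set.Ici 0))
    (ha_nonneg : ∀ r : ℝ, 0 ≤ r → 0 ≤ a r)
    (ha_pos : ∀ r : ℝ, 0 < r → 0 < a r)
    (ha_mono : MonotoneOn a (Set.Ici 0))
    (xbar : St n N) :
    ∃ x : ℝ → St n N, x 0 = xbar ∧ IsCaratheodorySolutionOn (fm a) x (Set.Ici 0) := by
  obtain ⟨K, hK⟩ := ha_lip
  obtain ⟨x, hx⟩ := exists_isPartialSolution_Ici (norm_fm_le ha_nonneg ha_mono)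
    (exists_local_solution_fm hK ha_nonneg (ha_pos 1 one_pos) ha_mono) xbar
  exact ⟨x, hx.isCaratheodorySolutionOn⟩
end
end
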